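/- Let 1 ≤ d ≤ m+1 and 1 ≤ r ≤ m+2−d. Then the r-th generalized Hamming weight of the projective square-free code satisfies (q−1)·d_r(C_d^{P,S}(m)) = (q−1)^{d−1} · q^{m−d−r+2} · (q^r − 1). -/

import Mathlib

/-- Square-free exponent vectors of total degree `d` in `m` variables. -/
def Sd (m d : ℕ) : Set (Fin m → ℕ) := {a | (∀ i, a i ≤ 1) ∧ ∑ i, a i = d}

/-- Square-free exponent vectors of total degree at most `d` in `m` variables. -/
def Sle (m d : ℕ) : Set (Fin m → ℕ) := {a | (∀ i, a i ≤ 1) ∧ ∑ i, a i ≤ d}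

/-- Evaluation code over the Cartesian set `X = A 0 × ⋯ × A (m-1)`, spanned by the
evaluations of the monomials `x^a` for `a ∈ S`. -/
noncomputable def evalCodeX {F : Type*} [Field F] {m : ℕ} (A : Fin m → Finset F)
    (S : Set (Fin m → ℕ)) :
    Submodule F ({P : Fin m → F // ∀ i, P i ∈ A i} → F) :=
  Submodule.span F ((fun (a : Fin m → ℕ) (P : {P : Fin m → F // ∀ i, P i ∈ A i}) =>
    ∏ i, P.1 i ^ a i) '' S)

open Classical in
/-- Support of a linear code. -/
noncomputable def codeSupp {F ι : Type*} [Field F] [Fintype ι]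
    (C : Submodule F (ι → F)) : Finset ι :=
  Finset.univ.filter (fun i => ∃ c ∈ C, c i ≠ 0)

/-- The `r`-th generalized Hamming weight of a linear code: the minimum cardinality of the
support of an `r`-dimensional subcode. -/
noncomputable def GHW {F ι : Type*} [Field F] [Fintype ι]
    (C : Submodule F (ι → F)) (r : ℕ) : ℕ :=
  sInf {k | ∃ C' : Submodule F (ι → F),
    C' ≤ C ∧ Module.finrank F C' = r ∧ (codeSupp C').card = k}

/-- Evaluation code: the span of the evaluations of the monomials `x^a`, `a ∈ S`, at the
family of points `pt : Y → F^N`. -/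
noncomputable def evCode {F : Type*} [Field F] {N : ℕ} {Y : Type*} (pt : Y → (Fin N → F))
    (S : Set (Fin N → ℕ)) : Submodule F (Y → F) :=
  Submodule.span F ((fun (a : Fin N → ℕ) (y : Y) => ∏ i, pt y i ^ a i) '' S)

theorem mem_codeSupp {F ι : Type*} [Field F] [Fintype ι] {C : Submodule F (ι → F)} {i : ι} :
    i ∈ codeSupp C ↔ ∃ c ∈ C, c i ≠ 0 := by
  simp [codeSupp]

theorem finrank_map_add_finrank_inf_ker {K M N : Type*} [Field K] [AddCommGroup M] [Module K M]
    [AddCommGroup N] [Module K N] [FiniteDimensional K M] (g : M →ₗ[K] N) (V : Submodule K M) :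
    Module.finrank K (V.map g) + Module.finrank K ↥(V ⊓ LinearMap.ker g) =
      Module.finrank K V := by
  rw [← LinearMap.finrank_range_add_finrank_ker (g.domRestrict V), LinearMap.range_domRestrict,
    LinearMap.ker_domRestrict, ← Submodule.map_comap_subtype, Submodule.finrank_map_subtype_eq]

/-- Restriction of functions to the hyperplane where the first variable is `t`. -/
def sliceAt {F : Type*} [Field F] (n : ℕ) (t : F) :
    ((Fin (n + 1) → F) → F) →ₗ[F] ((Fin n → F) → F) :=
  LinearMap.funLeft F F fun x => (Fin.cons t x : Fin (n + 1) → F)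

@[simp]
theorem sliceAt_apply {F : Type*} [Field F] {n : ℕ} (t : F) (f : (Fin (n + 1) → F) → F)
    (x : Fin n → F) : sliceAt n t f x = f (Fin.cons t x) := rfl

/-- Difference of the slices at `1` and `0` of the first variable: the coefficient of the first
variable for functions that are affine in it. -/
def sliceDiff (F : Type*) [Field F] (n : ℕ) :
    ((Fin (n + 1) → F) → F) →ₗ[F] ((Fin n → F) → F) :=
  sliceAt n 1 - sliceAt n 0

@[simp]
theorem sliceDiff_apply {F : Type*} [Field F] {n : ℕ} (f : (Fin (n + 1) → F) → F)
    (x : Fin n → F) :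
    sliceDiff F n f x = f (Fin.cons (1 : F) x) - f (Fin.cons (0 : F) x) := rfl

/-- The functions of a linear code that do not depend on the first variable, seen as functions of
the remaining variables. -/
def constSlice {F : Type*} [Field F] {n : ℕ} (V : Submodule F ((Fin (n + 1) → F) → F)) :
    Submodule F ((Fin n → F) → F) :=
  (V ⊓ LinearMap.ker (sliceDiff F n)).map (sliceAt n 0)

theorem card_le_card_fiber {F : Type*} [DecidableEq F] {n : ℕ} (T : Finset F)
    (S : Finset (Fin (n + 1) → F)) (x : Fin n → F)
    (h : ∀ t ∈ T, (Fin.cons t x : Fin (n + 1) → F) ∈ S) : T.card ≤ (S.filter fun v => Fin.tail v = x).card := by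
  refine Finset.card_le_card_of_injOn (fun t => Fin.cons t x) ?_ ?_
  · intro t ht
    simpa using h t ht
  · intro t _ t' _ h
    simpa using congrFun h 0

section Slices

variable {F : Type*} [Field F] {n : ℕ} {V : Submodule F ((Fin (n + 1) → F) → F)}

theorem finrank_slices [Fintype F]
    (hV : ∀ f ∈ V, ∀ t x, f (Fin.cons t x) = f (Fin.cons (0 : F) x) + t * sliceDiff F n f x) :
    Module.finrank F V =
      Module.finrank F (V.map (sliceDiff F n)) + Module.finrank F (constSlice V) := by
  have h : V ⊓ LinearMap.ker (sliceDiff F n) ⊓ LinearMap.ker (sliceAt n 0) = ⊥ := by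
    rw [eq_bot_iff]
    rintro f ⟨⟨hfV, hfD⟩, hf0⟩
    rw [SetLike.mem_coe, LinearMap.mem_ker] at hfD hf0
    rw [Submodule.mem_bot]
    funext v
    rw [← Fin.cons_self_tail v, hV f hfV, hfD]
    simpa using congrFun hf0 (Fin.tail v)
  have h2 := finrank_map_add_finrank_inf_ker (sliceAt n 0) (V ⊓ LinearMap.ker (sliceDiff F n))
  rw [h, finrank_bot, add_zero] at h2
  rw [← finrank_map_add_finrank_inf_ker (sliceDiff F n) V, ← h2, constSlice]

variable [Fintype F]

theorem cons_mem_codeSupp_of_constSlice {x : Fin n → F}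
    (hV : ∀ f ∈ V, ∀ t x, f (Fin.cons t x) = f (Fin.cons (0 : F) x) + t * sliceDiff F n f x)
    (hx : x ∈ codeSupp (constSlice V)) (t : F) : (Fin.cons t x : Fin (n + 1) → F) ∈ codeSupp V := by
  obtain ⟨_, ⟨f, ⟨hf, hD⟩, rfl⟩, hfx⟩ := mem_codeSupp.1 hx
  refine mem_codeSupp.2 ⟨f, hf, ?_⟩
  rw [hV f hf, LinearMap.mem_ker.1 hD]
  simpa using hfx

variable [DecidableEq F]

theorem card_fiber_of_mem_constSlice {x : Fin n → F}
    (hV : ∀ f ∈ V, ∀ t x, f (Fin.cons t x) = f (Fin.cons (0 : F) x) + t * sliceDiff F n f x)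
    (hx : x ∈ codeSupp (constSlice V)) :
    Fintype.card F ≤ ((codeSupp V).filter fun v => Fin.tail v = x).card :=
  card_le_card_fiber Finset.univ _ x fun t _ => cons_mem_codeSupp_of_constSlice hV hx t

theorem card_fiber_of_mem_map_sliceDiff {x : Fin n → F}
    (hV : ∀ f ∈ V, ∀ t x, f (Fin.cons t x) = f (Fin.cons (0 : F) x) + t * sliceDiff F n f x)
    (hx : x ∈ codeSupp (V.map (sliceDiff F n))) :
    Fintype.card F - 1 ≤ ((codeSupp V).filter fun v => Fin.tail v = x).card := by
  obtain ⟨_, ⟨f, hf, rfl⟩, hfx⟩ := mem_codeSupp.1 hx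
  set b := sliceDiff F n f x
  set a := f (Fin.cons (0 : F) x)
  rw [← Finset.card_univ, ← Finset.card_erase_of_mem (Finset.mem_univ (-a / b))]
  refine card_le_card_fiber _ _ x fun t ht => mem_codeSupp.2 ⟨f, hf, fun h => ?_⟩
  rw [hV f hf] at h
  refine Finset.ne_of_mem_erase ht ?_
  rw [eq_div_iff hfx]
  linear_combination h

theorem card_codeSupp_ge_constSlice
    (hV : ∀ f ∈ V, ∀ t x, f (Fin.cons t x) = f (Fin.cons (0 : F) x) + t * sliceDiff F n f x) :
    Fintype.card F * (codeSupp (constSlice V)).card ≤ (codeSupp V).card := by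
  rw [Finset.card_eq_sum_card_fiberwise (f := Fin.tail) (t := Finset.univ) (s := codeSupp V)
    (fun _ _ => Finset.mem_coe.2 (Finset.mem_univ _)), mul_comm, ← smul_eq_mul]
  refine (Finset.card_nsmul_le_sum _ _ _ fun x hx => card_fiber_of_mem_constSlice hV hx).trans ?_
  exact Finset.sum_le_sum_of_subset (Finset.subset_univ _)

theorem card_codeSupp_ge_add
    (hV : ∀ f ∈ V, ∀ t x, f (Fin.cons t x) = f (Fin.cons (0 : F) x) + t * sliceDiff F n f x) :
    (codeSupp (constSlice V)).card +
      (Fintype.card F - 1) * (codeSupp (V.map (sliceDiff F n))).card ≤ (codeSupp V).card := by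
  classical
  rw [Finset.card_eq_sum_card_fiberwise (f := Fin.tail) (t := Finset.univ) (s := codeSupp V)
    (fun _ _ => Finset.mem_coe.2 (Finset.mem_univ _))]
  have key (S : Finset (Fin n → F)) : S.card = ∑ x, if x ∈ S then 1 else 0 := by simp
  rw [key (codeSupp (constSlice V)), key (codeSupp (V.map _)), Finset.mul_sum,
    ← Finset.sum_add_distrib]
  refine Finset.sum_le_sum fun x _ => ?_
  have hq : 1 ≤ Fintype.card F := Fintype.card_pos
  by_cases h1 : x ∈ codeSupp (constSlice V)
  · have := card_fiber_of_mem_constSlice hV h1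
    split_ifs <;> omega
  · by_cases h2 : x ∈ codeSupp (V.map (sliceDiff F n))
    · have := card_fiber_of_mem_map_sliceDiff hV h2
      simp only [h1, h2, if_true, if_false]
      omega
    · simp [h1, h2]

end Slices

section SquareFree

variable {F : Type*} [Field F] {n d : ℕ} {f : (Fin (n + 1) → F) → F}

theorem Sle_apply_zero {a : Fin (n + 1) → ℕ} (ha : a ∈ Sle (n + 1) d) :
    a 0 = 0 ∨ a 0 = 1 := by
  have := ha.1 0
  omega

theorem tail_mem_Sle {a : Fin (n + 1) → ℕ} (ha : a ∈ Sle (n + 1) d) :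
    Fin.tail a ∈ Sle n (d - a 0) := by
  refine ⟨fun i => ha.1 i.succ, ?_⟩
  have := ha.2
  rw [Fin.sum_univ_succ] at this
  simp only [Fin.tail]
  omega

theorem Sle_mono {e : ℕ} (h : d ≤ e) : Sle n d ⊆ Sle n e := fun _ ha => ⟨ha.1, ha.2.trans h⟩

theorem evCode_mono {N : ℕ} {Y : Type*} (pt : Y → (Fin N → F)) {S T : Set (Fin N → ℕ)}
    (h : S ⊆ T) : evCode pt S ≤ evCode pt T :=
  Submodule.span_mono (Set.image_mono h)

theorem monomial_mem_evCode {N : ℕ} {Y : Type*} (pt : Y → (Fin N → F)) {S : Set (Fin N → ℕ)}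
    {a : Fin N → ℕ} (ha : a ∈ S) : (fun y => ∏ i, pt y i ^ a i) ∈ evCode pt S :=
  Submodule.subset_span ⟨a, ha, rfl⟩

theorem evCode_affine_first (hf : f ∈ evCode id (Sle (n + 1) d)) (t : F) (x : Fin n → F) :
    f (Fin.cons t x) = f (Fin.cons (0 : F) x) + t * sliceDiff F n f x := by
  induction hf using Submodule.span_induction with
  | mem f hf =>
    obtain ⟨a, ha, rfl⟩ := hf
    rcases Sle_apply_zero ha with h | h <;> simp [Fin.prod_univ_succ, h]
  | zero => simp
  | add f g _ _ hf hg =>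
    simp only [map_add, Pi.add_apply, hf, hg]
    ring
  | smul c f _ hf =>
    simp only [map_smul, Pi.smul_apply, hf, smul_eq_mul]
    ring

theorem slice_zero_mem_evCode (hf : f ∈ evCode id (Sle (n + 1) d)) :
    sliceAt n 0 f ∈ evCode id (Sle n d) := by
  suffices evCode (F := F) id (Sle (n + 1) d) ≤
      (evCode id (Sle n d)).comap (sliceAt n 0) from this hf
  refine Submodule.span_le.2 ?_
  rintro _ ⟨a, ha, rfl⟩
  rw [SetLike.mem_coe, Submodule.mem_comap]
  rcases Sle_apply_zero ha with h | h
  · have := monomial_mem_evCode (F := F) id (Sle_mono (Nat.sub_le _ _) (tail_mem_Sle ha))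
    convert this using 1
    funext x
    simp [Fin.prod_univ_succ, h, Fin.tail]
  · convert Submodule.zero_mem (evCode (F := F) id (Sle n d)) using 1
    funext x
    simp [Fin.prod_univ_succ, h]

theorem sliceDiff_mem_evCode (hf : f ∈ evCode id (Sle (n + 1) (d + 1))) :
    sliceDiff F n f ∈ evCode id (Sle n d) := by
  suffices evCode (F := F) id (Sle (n + 1) (d + 1)) ≤
      (evCode id (Sle n d)).comap (sliceDiff F n) from this hf
  refine Submodule.span_le.2 ?_
  rintro _ ⟨a, ha, rfl⟩
  rw [SetLike.mem_coe, Submodule.mem_comap]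
  rcases Sle_apply_zero ha with h | h
  · convert Submodule.zero_mem (evCode (F := F) id (Sle n d)) using 1
    funext x
    simp [Fin.prod_univ_succ, h]
  · have h' := tail_mem_Sle ha
    rw [h, Nat.add_sub_cancel] at h'
    convert monomial_mem_evCode (F := F) id h' using 1
    funext x
    simp [Fin.prod_univ_succ, h, Fin.tail]

theorem sliceDiff_eq_zero (hf : f ∈ evCode id (Sle (n + 1) 0)) : sliceDiff F n f = 0 := by
  suffices evCode (F := F) id (Sle (n + 1) 0) ≤ LinearMap.ker (sliceDiff F n) from this hf
  refine Submodule.span_le.2 ?_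
  rintro _ ⟨a, ha, rfl⟩
  have h : a 0 = 0 := Finset.sum_eq_zero_iff.1 (Nat.le_zero.1 ha.2) 0 (Finset.mem_univ _)
  rw [SetLike.mem_coe, LinearMap.mem_ker]
  funext x
  simp [Fin.prod_univ_succ, h]

theorem constSlice_le_evCode {V : Submodule F ((Fin (n + 1) → F) → F)}
    (hV : V ≤ evCode id (Sle (n + 1) d)) : constSlice V ≤ evCode id (Sle n d) := by
  rintro _ ⟨f, ⟨hf, -⟩, rfl⟩
  exact slice_zero_mem_evCode (hV hf)

/-- Lower bound for the support of a linear code of square-free polynomial functions of degree at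
most `d` on the affine space. -/
theorem card_codeSupp_squarefree_ge [Fintype F] [DecidableEq F]
    (n d : ℕ) (V : Submodule F ((Fin n → F) → F)) (hV : V ≤ evCode id (Sle n d)) :
    (Fintype.card F : ℝ) ^ (n + 1) * (((Fintype.card F : ℝ) - 1) / Fintype.card F) ^ d *
      (1 - ((Fintype.card F : ℝ)⁻¹) ^ Module.finrank F V) ≤
    ((Fintype.card F : ℝ) - 1) * (codeSupp V).card := by
  have hq : (1 : ℝ) < Fintype.card F := by exact_mod_cast Fintype.one_lt_card
  have hnat : 1 ≤ Fintype.card F := Fintype.card_pos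
  have hρ0 : 0 ≤ ((Fintype.card F : ℝ) - 1) / Fintype.card F := by
    apply div_nonneg <;> linarith
  have hρ1 : ((Fintype.card F : ℝ) - 1) / Fintype.card F ≤ 1 := by
    rw [div_le_one] <;> linarith
  have hi1 : (Fintype.card F : ℝ)⁻¹ ≤ 1 := inv_le_one_of_one_le₀ hq.le
  induction n generalizing d with
  | zero =>
    have hr : Module.finrank F V ≤ 1 := by simpa using V.finrank_le
    rcases Nat.le_one_iff_eq_zero_or_eq_one.1 hr with h | h
    · rw [h]
      simp only [pow_zero, sub_self, mul_zero]
      exact mul_nonneg (by linarith) (Nat.cast_nonneg _)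
    · have hc : 1 ≤ (codeSupp V).card := by
        obtain ⟨f, hf, hf0⟩ := V.exists_mem_ne_zero_of_ne_bot (by rintro rfl; simp at h)
        obtain ⟨x, hx⟩ := Function.ne_iff.1 hf0
        exact Finset.card_pos.2 ⟨x, mem_codeSupp.2 ⟨f, hf, hx⟩⟩
      have hc' : (1 : ℝ) ≤ (codeSupp V).card := by exact_mod_cast hc
      have hp := pow_le_one₀ (n := d) hρ0 hρ1
      have hqi : (Fintype.card F : ℝ) * (1 - (Fintype.card F : ℝ)⁻¹) = Fintype.card F - 1 := by
        field_simp
      rw [h]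
      simp only [zero_add, pow_one]
      calc _ = ((Fintype.card F : ℝ) - 1) *
            (((Fintype.card F : ℝ) - 1) / Fintype.card F) ^ d := by rw [← hqi]; ring
        _ ≤ _ := mul_le_mul_of_nonneg_left (hp.trans hc') (by linarith)
  | succ n ih =>
    have haff : ∀ f ∈ V, ∀ t x,
        f (Fin.cons t x) = f (Fin.cons (0 : F) x) + t * sliceDiff F n f x :=
      fun f hf t x => evCode_affine_first (hV hf) t x
    have hK := ih d _ (constSlice_le_evCode hV)
    have hr := finrank_slices haff
    rcases Nat.eq_zero_or_pos (Module.finrank F (V.map (sliceDiff F n))) with h0 | h0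
    · rw [h0, zero_add] at hr
      rw [hr]
      have hc : (Fintype.card F : ℝ) * (codeSupp (constSlice V)).card ≤ (codeSupp V).card := by
        exact_mod_cast card_codeSupp_ge_constSlice haff
      calc _ = (Fintype.card F : ℝ) * _ := by rw [pow_succ' _ (n + 1)]; simp only [mul_assoc]
        _ ≤ _ := mul_le_mul_of_nonneg_left hK (by linarith)
        _ ≤ _ := by
          rw [mul_left_comm]
          exact mul_le_mul_of_nonneg_left hc (by linarith)
    · cases d with
      | zero =>
        exfalso
        have : V.map (sliceDiff F n) = ⊥ := by
          rw [eq_bot_iff]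
          rintro _ ⟨f, hf, rfl⟩
          simpa using sliceDiff_eq_zero (hV hf)
        rw [this] at h0
        simp at h0
      | succ d =>
        have hH := ih d (V.map (sliceDiff F n)) (by
          rintro _ ⟨f, hf, rfl⟩
          exact sliceDiff_mem_evCode (hV hf))
        have hc : ((codeSupp (constSlice V)).card : ℝ) + ((Fintype.card F : ℝ) - 1) *
            (codeSupp (V.map (sliceDiff F n))).card ≤ (codeSupp V).card := by
          have := card_codeSupp_ge_add haff
          have h2 : ((Fintype.card F - 1 : ℕ) : ℝ) = (Fintype.card F : ℝ) - 1 := by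
            push_cast [hnat]; rfl
          rw [← h2]
          exact_mod_cast this
        rw [hr]
        set q : ℝ := (Fintype.card F : ℝ)
        set r₁ := Module.finrank F (V.map (sliceDiff F n))
        set r₂ := Module.finrank F (constSlice V)
        have hx : q⁻¹ ^ r₁ ≤ q⁻¹ := pow_le_of_le_one (by positivity) hi1 h0.ne'
        have hy : q⁻¹ ^ r₂ ≤ 1 := pow_le_one₀ (by positivity) hi1
        have hqρ : q * ((q - 1) / q) = q - 1 := by field_simp
        have h3 : q ^ (n + 1) * ((q - 1) / q) ^ (d + 1) *
            (q * (1 - q⁻¹ ^ (r₁ + r₂))) ≤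
            q ^ (n + 1) * ((q - 1) / q) ^ (d + 1) *
            (1 - q⁻¹ ^ r₂ + q * (1 - q⁻¹ ^ r₁)) := by
          refine mul_le_mul_of_nonneg_left ?_ (by positivity)
          have h5 : q * q⁻¹ ^ r₁ ≤ 1 := by
            calc _ ≤ q * q⁻¹ := by gcongr
              _ = 1 := by field_simp
          rw [pow_add]
          nlinarith [mul_nonneg (sub_nonneg.2 h5) (sub_nonneg.2 hy)]
        have h4 : q ^ (n + 1) * ((q - 1) / q) ^ (d + 1) * (q * (1 - q⁻¹ ^ r₁)) =
            (q - 1) * (q ^ (n + 1) * ((q - 1) / q) ^ d * (1 - q⁻¹ ^ r₁)) := by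
          linear_combination
            q ^ (n + 1) * ((q - 1) / q) ^ d * (1 - q⁻¹ ^ r₁) * hqρ
        have hm := mul_le_mul_of_nonneg_left hH (sub_nonneg.2 hq.le)
        have hm2 := mul_le_mul_of_nonneg_left hc (sub_nonneg.2 hq.le)
        calc _ = q ^ (n + 1) * ((q - 1) / q) ^ (d + 1) * (q * (1 - q⁻¹ ^ (r₁ + r₂))) := by ring
          _ ≤ _ := h3
          _ ≤ (q - 1) * (codeSupp V).card := by
            rw [mul_add, h4]
            linarith

end SquareFree

section Projective

variable {F : Type*} [Field F] {N d : ℕ}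

theorem Sd_subset_Sle : Sd N d ⊆ Sle N d := fun _ ha => ⟨ha.1, ha.2.le⟩

theorem map_funLeft_evCode {Y : Type*} (pt : Y → (Fin N → F)) (S : Set (Fin N → ℕ)) :
    (evCode id S).map (LinearMap.funLeft F F pt) = evCode pt S := by
  rw [evCode, Submodule.map_span, ← Set.image_comp]
  rfl

theorem evCode_smul {f : (Fin N → F) → F} (hf : f ∈ evCode id (Sd N d)) (c : F)
    (x : Fin N → F) : f (c • x) = c ^ d * f x := by
  induction hf using Submodule.span_induction with
  | mem f hf =>
    obtain ⟨a, ha, rfl⟩ := hf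
    simp [mul_pow, Finset.prod_mul_distrib, Finset.prod_pow_eq_pow_sum, ha.2]
  | zero => simp
  | add f g _ _ hf hg =>
    simp only [Pi.add_apply, hf, hg]
    ring
  | smul b f _ hf =>
    simp only [Pi.smul_apply, hf, smul_eq_mul]
    ring

theorem evCode_apply_zero (hd : 1 ≤ d) {f : (Fin N → F) → F} (hf : f ∈ evCode id (Sd N d)) :
    f 0 = 0 := by
  simpa [Nat.one_le_iff_ne_zero.1 hd] using evCode_smul hf 0 0

variable {Pm : Finset (Fin N → F)}

theorem disjoint_evCode_ker_restrict
    (hrep : ∀ v : Fin N → F, v ≠ 0 →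
      ∃! p : Fˣ × (Fin N → F), p.2 ∈ Pm ∧ v = (p.1 : F) • p.2)
    (hd : 1 ≤ d) :
    Disjoint (evCode id (Sd N d))
      (LinearMap.ker (LinearMap.funLeft F F fun Q : {Q // Q ∈ Pm} => (Q : Fin N → F))) := by
  rw [Submodule.disjoint_def]
  intro f hf hk
  funext v
  by_cases hv : v = 0
  · rw [hv, evCode_apply_zero hd hf, Pi.zero_apply]
  · obtain ⟨⟨u, Q⟩, ⟨hQ, rfl⟩, -⟩ := hrep v hv
    have : f Q = 0 := congrFun (LinearMap.mem_ker.1 hk) ⟨Q, hQ⟩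
    rw [evCode_smul hf, this, mul_zero, Pi.zero_apply]

theorem card_codeSupp_eq_projective [Fintype F]
    (hrep : ∀ v : Fin N → F, v ≠ 0 →
      ∃! p : Fˣ × (Fin N → F), p.2 ∈ Pm ∧ v = (p.1 : F) • p.2)
    (hd : 1 ≤ d)
    (hPm0 : ∀ Q ∈ Pm, Q ≠ 0)
    {V : Submodule F ((Fin N → F) → F)} (hV : V ≤ evCode id (Sd N d)) :
    (codeSupp V).card = (Fintype.card F - 1) *
      (codeSupp (V.map
        (LinearMap.funLeft F F fun Q : {Q // Q ∈ Pm} => (Q : Fin N → F)))).card := by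
  classical
  rw [← Fintype.card_units, ← Finset.card_univ, ← Finset.card_product]
  symm
  refine Finset.card_nbij (fun p => (p.1 : F) • (p.2 : Fin N → F)) ?_ ?_ ?_
  · rintro ⟨u, Q⟩ h
    obtain ⟨_, ⟨f, hf, rfl⟩, hfQ⟩ := mem_codeSupp.1 (Finset.mem_product.1 h).2
    refine mem_codeSupp.2 ⟨f, hf, ?_⟩
    rw [evCode_smul (hV hf)]
    exact mul_ne_zero (pow_ne_zero _ u.ne_zero) hfQ
  · rintro ⟨u, Q⟩ - ⟨u', Q'⟩ - h
    obtain ⟨p, -, hp⟩ := hrep ((u : F) • (Q : Fin N → F))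
      (smul_ne_zero u.ne_zero (hPm0 _ Q.2))
    have h1 := (hp (u, Q) ⟨Q.2, rfl⟩).trans (hp (u', Q') ⟨Q'.2, h⟩).symm
    rw [Prod.mk.injEq] at h1
    exact Prod.ext h1.1 (Subtype.ext h1.2)
  · intro v hv
    obtain ⟨f, hf, hfv⟩ := mem_codeSupp.1 hv
    have hv0 : v ≠ 0 := by
      rintro rfl
      exact hfv (evCode_apply_zero hd (hV hf))
    obtain ⟨⟨u, Q⟩, ⟨hQ, rfl⟩, -⟩ := hrep v hv0
    refine ⟨(u, ⟨Q, hQ⟩), ?_, rfl⟩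
    rw [evCode_smul (hV hf)] at hfv
    exact Finset.mem_coe.2 (Finset.mem_product.2 ⟨Finset.mem_univ _,
      mem_codeSupp.2 ⟨_, ⟨f, hf, rfl⟩, right_ne_zero_of_mul hfv⟩⟩)

end Projective

section Extremal

/-- The exponent vector of `x₀ ⋯ x_{k-1} x_{k+j}`. -/
def starExponent (N k j : ℕ) (i : Fin N) : ℕ := if i.1 < k ∨ i.1 = k + j then 1 else 0

theorem starExponent_mem_Sd {N k j : ℕ} (h : k + j < N) : starExponent N k j ∈ Sd N (k + 1) := by
  refine ⟨fun i => by unfold starExponent; split_ifs <;> omega, ?_⟩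
  have key (i : Fin N) : starExponent N k j i =
      (if i.1 < k then 1 else 0) + if i = ⟨k + j, h⟩ then 1 else 0 := by
    simp only [starExponent, Fin.ext_iff]
    split_ifs <;> omega
  simp only [key, Finset.sum_add_distrib, Finset.sum_boole, Fin.card_filter_val_lt,
    Finset.filter_eq', Finset.mem_univ, if_true, Finset.card_singleton, Nat.cast_id]
  omega

variable {F : Type*} [Field F] {N k : ℕ}

theorem starMonomial_apply {j : ℕ} (h : k + j < N) (x : Fin N → F) :
    ∏ i, x i ^ starExponent N k j i =
      (∏ i with i.1 < k, x i) * x ⟨k + j, h⟩ := by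
  have key (i : Fin N) : x i ^ starExponent N k j i =
      (if i.1 < k then x i else 1) * if i = ⟨k + j, h⟩ then x i else 1 := by
    simp only [starExponent, Fin.ext_iff]
    split_ifs <;> first | omega | simp
  simp only [key, Finset.prod_mul_distrib, Finset.prod_filter, Finset.prod_ite_eq',
    Finset.mem_univ, if_true]

theorem starMonomial_ne_zero_iff {j : ℕ} (h : k + j < N) (x : Fin N → F) :
    ∏ i, x i ^ starExponent N k j i ≠ 0 ↔ (∀ i : Fin N, i.1 < k → x i ≠ 0) ∧ x ⟨k + j, h⟩ ≠ 0 := by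
  rw [starMonomial_apply h, mul_ne_zero_iff, Finset.prod_ne_zero_iff]
  simp

/-- The span of the monomials `x₀ ⋯ x_{k-1} x_{k+j}` for `j < r`. -/
def starCode (F : Type*) [Field F] (N k r : ℕ) : Submodule F ((Fin N → F) → F) :=
  Submodule.span F (Set.range fun (j : Fin r) (x : Fin N → F) => ∏ i, x i ^ starExponent N k j i)

theorem starCode_le {r : ℕ} (h : k + r ≤ N) : starCode F N k r ≤ evCode id (Sd N (k + 1)) := by
  refine Submodule.span_le.2 ?_
  rintro _ ⟨j, rfl⟩
  exact monomial_mem_evCode (F := F) id (starExponent_mem_Sd (by omega))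

theorem linearIndependent_starMonomial {r : ℕ} (h : k + r ≤ N) :
    LinearIndependent F fun (j : Fin r) (x : Fin N → F) => ∏ i, x i ^ starExponent N k j i := by
  rw [Fintype.linearIndependent_iff]
  intro g hg l
  have := congrFun hg fun i => if i.1 < k ∨ i.1 = k + l then 1 else 0
  simp only [Finset.sum_apply, Pi.smul_apply, smul_eq_mul, Pi.zero_apply] at this
  rw [Finset.sum_eq_single l] at this
  · rw [starMonomial_apply (by omega)] at this
    rw [Finset.prod_congr rfl (g := fun _ => (1 : F)) fun i hi => by
      simp [(Finset.mem_filter.1 hi).2]] at this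
    simpa using this
  · intro j _ hj
    rw [starMonomial_apply (by omega)]
    have : ¬ (j : ℕ) = l := fun h => hj (Fin.ext h)
    simp [this]
  · simp

theorem mem_codeSupp_starCode [Fintype F] {r : ℕ} (h : k + r ≤ N) (x : Fin N → F) :
    x ∈ codeSupp (starCode F N k r) ↔ (∀ i : Fin N, i.1 < k → x i ≠ 0) ∧
      ∃ i : Fin N, k ≤ i.1 ∧ i.1 < k + r ∧ x i ≠ 0 := by
  rw [mem_codeSupp]
  constructor
  · rintro ⟨c, hc, hcx⟩
    by_contra hx
    refine hcx ?_
    suffices starCode F N k r ≤ LinearMap.ker (LinearMap.proj x) from this hc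
    refine Submodule.span_le.2 ?_
    rintro _ ⟨j, rfl⟩
    rw [SetLike.mem_coe, LinearMap.mem_ker, LinearMap.proj_apply]
    by_contra hj
    rw [← ne_eq, starMonomial_ne_zero_iff (by omega)] at hj
    exact hx ⟨hj.1, _, by simp, by simp, hj.2⟩
  · rintro ⟨h0, i, hi1, hi2, hi⟩
    refine ⟨_, Submodule.subset_span ⟨⟨i - k, by omega⟩, rfl⟩, ?_⟩
    rw [starMonomial_ne_zero_iff (by simp; omega)]
    refine ⟨h0, ?_⟩
    convert hi
    simp; omega

theorem card_codeSupp_starCode [Fintype F] {r : ℕ} (h : k + r ≤ N) :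
    (codeSupp (starCode F N k r)).card =
      (Fintype.card F - 1) ^ k * Fintype.card F ^ (N - k - r) * (Fintype.card F ^ r - 1) := by
  classical
  obtain ⟨s, rfl⟩ := Nat.exists_eq_add_of_le h
  set A : Finset (Fin (k + r + s) → F) :=
    Fintype.piFinset fun i => if i.1 < k then {0}ᶜ else Finset.univ
  set B : Finset (Fin (k + r + s) → F) :=
    Fintype.piFinset fun i => if i.1 < k then {0}ᶜ else if i.1 < k + r then {0} else Finset.univ
  have hBA : B ⊆ A := Fintype.piFinset_subset _ _ fun i => by
    split_ifs <;> simp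
  have hAB : codeSupp (starCode F (k + r + s) k r) = A \ B := by
    ext x
    have hA : x ∈ A ↔ ∀ i : Fin (k + r + s), i.1 < k → x i ≠ 0 := by
      refine Fintype.mem_piFinset.trans (forall_congr' fun i => ?_)
      split_ifs with hi <;> simp [hi]
    have hB : x ∈ B ↔ ∀ i : Fin (k + r + s), (i.1 < k → x i ≠ 0) ∧
        (k ≤ i.1 → i.1 < k + r → x i = 0) := by
      refine Fintype.mem_piFinset.trans (forall_congr' fun i => ?_)
      split_ifs with hi hi'
      · simp [hi, hi.not_ge]
      · simp [hi, hi', not_lt.1 hi]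
      · simp [hi, hi']
    rw [mem_codeSupp_starCode h, Finset.mem_sdiff, hA, hB]
    refine and_congr_right fun h0 => ?_
    push Not
    exact exists_congr fun i => ⟨fun hi _ => hi, fun hi => hi (h0 i)⟩
  have hAc : A.card = (Fintype.card F - 1) ^ k * Fintype.card F ^ (r + s) := by
    have hlt (x : ℕ) : ¬ k + r + x < k := by omega
    simp [A, hlt, Fintype.card_piFinset, Fin.prod_univ_add, Finset.card_compl, pow_add, mul_assoc]
  have hBc : B.card = (Fintype.card F - 1) ^ k * Fintype.card F ^ s := by
    simp [B, Fintype.card_piFinset, Fin.prod_univ_add, Finset.card_compl, add_assoc]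
  rw [hAB, Finset.card_sdiff_of_subset hBA, hAc, hBc, Nat.mul_sub, mul_one,
    show k + r + s - k - r = s by omega, pow_add]
  congr 1
  ring

end Extremal

/-- Let `1 ≤ d ≤ m+1` and `1 ≤ r ≤ m+2−d`. The `r`-th generalized
Hamming weight of the projective square-free code `C_d^{P,S}(m)` satisfies
`(q−1) · d_r(C_d^{P,S}(m)) = (q−1)^{d−1} · q^{m−d−r+2} · (q^r − 1)`. -/
theorem ghw_projective_squarefree_formula
    {F : Type*} [Field F] [Fintype F] [DecidableEq F] {m d r : ℕ}
    (hd1 : 1 ≤ d) (hdm : d ≤ m + 1) (hr1 : 1 ≤ r) (hr2 : r ≤ m + 2 - d)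
    (Pm : Finset (Fin (m + 1) → F))
    (hPm0 : ∀ Q ∈ Pm, Q ≠ 0)
    (hrep : ∀ v : Fin (m + 1) → F, v ≠ 0 →
      ∃! p : Fˣ × (Fin (m + 1) → F), p.2 ∈ Pm ∧ v = (p.1 : F) • p.2) :
    (Fintype.card F - 1) *
        GHW (evCode (fun Q : {Q // Q ∈ Pm} => (Q : Fin (m + 1) → F)) (Sd (m + 1) d)) r =
      (Fintype.card F - 1) ^ (d - 1) * Fintype.card F ^ (m + 2 - d - r) *
        (Fintype.card F ^ r - 1) := by
  set R := LinearMap.funLeft F F fun Q : {Q // Q ∈ Pm} => (Q : Fin (m + 1) → F)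
  have hmap : (evCode id (Sd (m + 1) d)).map R = evCode _ (Sd (m + 1) d) :=
    map_funLeft_evCode _ _
  have hkr : d - 1 + r ≤ m + 1 := by omega
  have hstar : starCode F (m + 1) (d - 1) r ≤ evCode id (Sd (m + 1) d) := by
    simpa [Nat.sub_add_cancel hd1] using starCode_le (F := F) hkr
  have hcard := card_codeSupp_starCode (F := F) hkr
  rw [show m + 1 - (d - 1) - r = m + 2 - d - r by omega] at hcard
  have hmem : (codeSupp ((starCode F (m + 1) (d - 1) r).map R)).card ∈
      {k | ∃ C' : Submodule F ({Q // Q ∈ Pm} → F),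
        C' ≤ evCode (fun Q : {Q // Q ∈ Pm} => (Q : Fin (m + 1) → F)) (Sd (m + 1) d) ∧
        Module.finrank F C' = r ∧ (codeSupp C').card = k} := by
    refine ⟨_, hmap ▸ Submodule.map_mono hstar, ?_, rfl⟩
    have hli := (linearIndependent_starMonomial (F := F) hkr).map (f := R)
      ((disjoint_evCode_ker_restrict hrep hd1).mono_left hstar)
    rw [starCode, Submodule.map_span, ← Set.range_comp, finrank_span_eq_card hli,
      Fintype.card_fin]
  rw [← hcard]
  apply le_antisymm
  · rw [card_codeSupp_eq_projective hrep hd1 hPm0 hstar]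
    exact Nat.mul_le_mul_left _ (Nat.sInf_le hmem)
  · obtain ⟨C, hC, hCr, hCk⟩ := Nat.sInf_mem ⟨_, hmem⟩
    unfold GHW
    rw [← hCk, hcard]
    set V := evCode id (Sd (m + 1) d) ⊓ C.comap R
    have hVle : V ≤ evCode id (Sd (m + 1) d) := inf_le_left
    have hVC : V.map R = C := by
      rw [← Submodule.map_inf_eq_map_inf_comap, hmap]
      exact inf_eq_right.2 hC
    have hrV : r ≤ Module.finrank F V := by
      rw [← hCr, ← hVC]
      exact Submodule.finrank_map_le _ _
    have hb := card_codeSupp_squarefree_ge (m + 1) d V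
      (hVle.trans (evCode_mono _ Sd_subset_Sle))
    have hp := card_codeSupp_eq_projective hrep hd1 hPm0 hVle
    rw [hVC] at hp
    rw [← hp]
    have hq : (1 : ℝ) < Fintype.card F := by exact_mod_cast Fintype.one_lt_card
    obtain ⟨k, rfl⟩ := Nat.exists_eq_add_of_le' hd1
    obtain ⟨s, hs⟩ := Nat.exists_eq_add_of_le hkr
    rw [Nat.add_sub_cancel] at hs
    rw [show m + 2 - (k + 1) - r = s by omega, Nat.add_sub_cancel]
    rw [show (Fintype.card F : ℝ) ^ (m + 1 + 1) = (Fintype.card F : ℝ) ^ (k + r + s + 1) by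
      rw [hs]] at hb
    have hone : 1 ≤ Fintype.card F := Fintype.card_pos
    rw [← Nat.cast_le (α := ℝ)]
    push_cast [hone, Nat.one_le_pow _ _ hone]
    set q : ℝ := (Fintype.card F : ℝ)
    have hpow : q⁻¹ ^ Module.finrank F V ≤ q⁻¹ ^ r :=
      pow_le_pow_of_le_one (by positivity) (inv_le_one_of_one_le₀ hq.le) hrV
    refine le_of_mul_le_mul_left ?_ (sub_pos.2 hq)
    refine le_trans ?_ hb
    have hq1 : 0 ≤ (q - 1) / q := div_nonneg (sub_nonneg.2 hq.le) (by positivity)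
    calc (q - 1) * ((q - 1) ^ k * q ^ s * (q ^ r - 1)) =
          q ^ (k + r + s + 1) * ((q - 1) / q) ^ (k + 1) * (1 - q⁻¹ ^ r) := by
            have : q ≠ 0 := by positivity
            rw [div_pow, inv_pow]
            field_simp
            ring
      _ ≤ _ := mul_le_mul_of_nonneg_left (by linarith) (by positivity)
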